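/- Let p, q be probability vectors on Fin d whose entries are decreasingly ordered (p i ≥ p j and q i ≥ q j whenever i ≤ j), with q i > 0 for all i. Then the following are equivalent: (a) there exist m ≥ 1 and a probability vector r on Fin m with r j > 0 for all j such that min_{0 ≤ l ≤ dm−1} C_l(p ⊗ r)/C_l(q ⊗ r) > min_{0 ≤ l ≤ d−1} C_l(p)/C_l(q); (b) min_{0 ≤ l ≤ d−1} C_l(p)/C_l(q) < min (p (d−1) / q (d−1)) 1. -/

import Mathlib

open Finset

/-- max over finsets of card k of the sum of entries -/
noncomputable def maxSum {ι : Type*} [Fintype ι] (p : ι → ℝ) (k : ℕ) : ℝ :=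
  sSup {x : ℝ | ∃ S : Finset ι, S.card = k ∧ x = ∑ i ∈ S, p i}

/-- a probability vector: nonnegative entries summing to one -/
def IsProbVec {ι : Type*} [Fintype ι] (p : ι → ℝ) : Prop :=
  (∀ i, 0 ≤ p i) ∧ ∑ i, p i = 1

/-- tensor product of two vectors -/
def tensor {ι κ : Type*} (p : ι → ℝ) (r : κ → ℝ) : ι × κ → ℝ :=
  fun x => p x.1 * r x.2

/-- `C_l(x) = 1 - max_{|S| = l} ∑_{i ∈ S} x i`, the sum of the smallest
`n - l` entries of `x`. -/
noncomputable def Cl {ι : Type*} [Fintype ι] (x : ι → ℝ) (l : ℕ) : ℝ :=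
  1 - maxSum x l

/-- optimal conversion probability: `min_{0 ≤ l ≤ n-1} C_l(p)/C_l(q)` -/
noncomputable def Pconv {ι : Type*} [Fintype ι] (n : ℕ) (p q : ι → ℝ) : ℝ :=
  sInf {x : ℝ | ∃ l < n, x = Cl p l / Cl q l}

section MinimalSums

variable {ι : Type*} [Fintype ι]

lemma finite_cardSums (x : ι → ℝ) (l : ℕ) :
    {a : ℝ | ∃ S : Finset ι, S.card = l ∧ a = ∑ i ∈ S, x i}.Finite := by
  refine (Set.finite_range fun S : Finset ι => ∑ i ∈ S, x i).subset ?_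
  rintro a ⟨S, -, rfl⟩
  exact ⟨S, rfl⟩

lemma Cl_le_sum {x : ι → ℝ} (hx : IsProbVec x) (T : Finset ι) {l : ℕ}
    (hT : T.card + l = Fintype.card ι) : Cl x l ≤ ∑ i ∈ T, x i := by
  classical
  have hle : ∑ i ∈ Tᶜ, x i ≤ maxSum x l :=
    le_csSup (finite_cardSums x l).bddAbove ⟨Tᶜ, by rw [card_compl]; omega, rfl⟩
  have hsum := sum_add_sum_compl T x
  rw [hx.2] at hsum
  unfold Cl
  linarith

lemma exists_sum_eq_Cl {x : ι → ℝ} (hx : IsProbVec x) {l : ℕ} (hl : l ≤ Fintype.card ι) :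
    ∃ T : Finset ι, T.card + l = Fintype.card ι ∧ Cl x l = ∑ i ∈ T, x i := by
  classical
  obtain ⟨S₀, -, hS₀⟩ := exists_subset_card_eq (s := (univ : Finset ι)) (n := l) (by simpa using hl)
  obtain ⟨S, hS, hmax⟩ :=
    Set.Nonempty.csSup_mem (s := {a : ℝ | ∃ S : Finset ι, S.card = l ∧ a = ∑ i ∈ S, x i})
      ⟨_, S₀, hS₀, rfl⟩ (finite_cardSums x l)
  refine ⟨Sᶜ, by rw [card_compl]; omega, ?_⟩
  have hsum := sum_add_sum_compl S x
  rw [hx.2] at hsum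
  have hmax' : maxSum x l = ∑ i ∈ S, x i := hmax
  unfold Cl
  linarith

lemma Cl_zero (x : ι → ℝ) : Cl x 0 = 1 := by
  simp [Cl, maxSum]

lemma Cl_nonneg {x : ι → ℝ} (hx : IsProbVec x) {l : ℕ} (hl : l ≤ Fintype.card ι) :
    0 ≤ Cl x l := by
  obtain ⟨T, -, h⟩ := exists_sum_eq_Cl hx hl
  rw [h]
  exact sum_nonneg fun i _ => hx.1 i

lemma Cl_pos {x : ι → ℝ} (hx : IsProbVec x) (hpos : ∀ i, 0 < x i) {l : ℕ}
    (hl : l < Fintype.card ι) : 0 < Cl x l := by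
  obtain ⟨T, hT, h⟩ := exists_sum_eq_Cl hx hl.le
  rw [h]
  exact sum_pos (fun i _ => hpos i) (card_pos.1 (by omega))

/-- The last `C_l` is the smallest entry. -/
lemma Cl_eq_of_forall_le {x : ι → ℝ} (hx : IsProbVec x) {l : ℕ} (hl : l + 1 = Fintype.card ι)
    (i : ι) (hi : ∀ j, x i ≤ x j) : Cl x l = x i := by
  apply le_antisymm
  · simpa using Cl_le_sum hx {i} (l := l) (by rw [card_singleton]; omega)
  · obtain ⟨T, hT, h⟩ := exists_sum_eq_Cl hx (l := l) (by omega)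
    obtain ⟨j, rfl⟩ := card_eq_one.1 (show T.card = 1 by omega)
    rw [h, sum_singleton]
    exact hi j

lemma finite_ratios (n : ℕ) (x y : ι → ℝ) :
    {a : ℝ | ∃ l < n, a = Cl x l / Cl y l}.Finite := by
  refine ((Set.finite_lt_nat n).image fun l => Cl x l / Cl y l).subset ?_
  rintro a ⟨l, hl, rfl⟩
  exact ⟨l, hl, rfl⟩

lemma Pconv_le {n : ℕ} (x y : ι → ℝ) {l : ℕ} (hl : l < n) :
    Pconv n x y ≤ Cl x l / Cl y l :=
  csInf_le (finite_ratios n x y).bddBelow ⟨l, hl, rfl⟩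

lemma exists_Pconv_eq {n : ℕ} (hn : 0 < n) (x y : ι → ℝ) :
    ∃ l < n, Pconv n x y = Cl x l / Cl y l :=
  Set.Nonempty.csInf_mem (s := {a : ℝ | ∃ l < n, a = Cl x l / Cl y l}) ⟨_, 0, hn, rfl⟩ (finite_ratios n x y)

/-- The conversion probability is bounded by one and by the ratio of the smallest entries. -/
lemma Pconv_le_min {n : ℕ} {x y : ι → ℝ} (hx : IsProbVec x) (hy : IsProbVec y)
    (hn : n = Fintype.card ι) (i : ι) (hxi : ∀ j, x i ≤ x j) (hyi : ∀ j, y i ≤ y j) :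
    Pconv n x y ≤ min (x i / y i) 1 := by
  have hn0 : 0 < n := hn ▸ Fintype.card_pos_iff.2 ⟨i⟩
  apply le_min
  · have h := Pconv_le x y (show n - 1 < n by omega)
    rwa [Cl_eq_of_forall_le hx (by omega) i hxi, Cl_eq_of_forall_le hy (by omega) i hyi] at h
  · simpa [Cl_zero] using Pconv_le x y hn0

/-- If every `C_l(x)` dominates `c * C_l(y)`, the same holds for the sums of positive parts. -/
lemma sum_posPart_le {x y : ι → ℝ} (hx : IsProbVec x) (hy : IsProbVec y) {c : ℝ}
    (h : ∀ l < Fintype.card ι, c * Cl y l ≤ Cl x l) (t : ℝ) :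
    ∑ i, max (t - x i) 0 ≤ ∑ i, max (t - c * y i) 0 := by
  classical
  set T : Finset ι := univ.filter fun i => x i < t with hTdef
  have hTx : ∑ i, max (t - x i) 0 = ∑ i ∈ T, (t - x i) := by
    rw [hTdef, sum_filter]
    refine sum_congr rfl fun i _ => ?_
    split_ifs with hi
    · exact max_eq_left (by linarith)
    · exact max_eq_right (by linarith)
  rw [hTx]
  rcases T.eq_empty_or_nonempty with hT | hT
  · rw [hT, sum_empty]
    exact sum_nonneg fun i _ => le_max_right _ _
  · have hle : T.card ≤ Fintype.card ι := card_le_univ T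
    have hpos := hT.card_pos
    obtain ⟨T', hT', hy'⟩ := exists_sum_eq_Cl hy (l := Fintype.card ι - T.card) (by omega)
    have h1 := Cl_le_sum hx T (l := Fintype.card ι - T.card) (by omega)
    have h2 := h (Fintype.card ι - T.card) (by omega)
    have hcard : (T'.card : ℝ) = T.card := by
      have : T'.card = T.card := by omega
      exact_mod_cast this
    calc ∑ i ∈ T, (t - x i) = T.card * t - ∑ i ∈ T, x i := by
          rw [sum_sub_distrib, sum_const, nsmul_eq_mul]
      _ ≤ T'.card * t - c * ∑ i ∈ T', y i := by rw [hcard, ← hy']; linarith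
      _ = ∑ i ∈ T', (t - c * y i) := by
          rw [sum_sub_distrib, sum_const, nsmul_eq_mul, mul_sum]
      _ ≤ ∑ i ∈ T', max (t - c * y i) 0 := sum_le_sum fun i _ => le_max_left _ _
      _ ≤ ∑ i, max (t - c * y i) 0 :=
          sum_le_sum_of_subset_of_nonneg (subset_univ _) fun i _ _ => le_max_right _ _

/-- `C_l(y)` is realised by a set whose entries are separated by some threshold from the entries
outside it. -/
lemma exists_threshold {y : ι → ℝ} (hy : IsProbVec y) {l : ℕ} (hl : l < Fintype.card ι) :
    ∃ T : Finset ι, T.card + l = Fintype.card ι ∧ Cl y l = ∑ i ∈ T, y i ∧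
      ∃ s : ℝ, (∀ i ∈ T, y i ≤ s) ∧ ∀ j ∉ T, s ≤ y j := by
  classical
  obtain ⟨T, hT, hsum⟩ := exists_sum_eq_Cl hy hl.le
  obtain ⟨i, hiT, hi⟩ := T.exists_max_image y (card_pos.1 (by omega))
  refine ⟨T, hT, hsum, y i, hi, fun j hj => ?_⟩
  have hj' : j ∉ T.erase i := fun h => hj (mem_of_mem_erase h)
  have hswap := Cl_le_sum hy (insert j (T.erase i)) (l := l) (by
    rw [card_insert_of_notMem hj', card_erase_add_one hiT, hT])
  rw [sum_insert hj', hsum, ← add_sum_erase T y hiT] at hswap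
  linarith

/-- Strict domination of the sums of positive parts gives a strict bound on the conversion
probability. -/
lemma lt_Pconv {n : ℕ} {x y : ι → ℝ} (hx : IsProbVec x) (hy : IsProbVec y)
    (hypos : ∀ i, 0 < y i) (hn : n = Fintype.card ι) (hn0 : 0 < n) {c μ : ℝ} (hc : 0 ≤ c)
    (hμ : ∀ i, μ < x i)
    (h : ∀ t, μ < t → ∑ i, max (t - x i) 0 < ∑ i, max (t - c * y i) 0) :
    c < Pconv n x y := by
  classical
  subst hn
  obtain ⟨l, hl, hP⟩ := exists_Pconv_eq hn0 x y
  rw [hP, lt_div_iff₀ (Cl_pos hy hypos hl)]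
  obtain ⟨T, hT, hyT, s, hs, hs'⟩ := exists_threshold hy hl
  obtain ⟨T', hT', hxT⟩ := exists_sum_eq_Cl hx hl.le
  have hcard : (T'.card : ℝ) = T.card := by
    have : T'.card = T.card := by omega
    exact_mod_cast this
  rw [hyT, hxT, mul_sum]
  rcases le_or_gt (c * s) μ with hsμ | hsμ
  · calc ∑ i ∈ T, c * y i ≤ ∑ i ∈ T, μ :=
          sum_le_sum fun i hi => (mul_le_mul_of_nonneg_left (hs i hi) hc).trans hsμ
      _ = ∑ i ∈ T', μ := by rw [sum_const, sum_const, nsmul_eq_mul, nsmul_eq_mul, hcard]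
      _ < ∑ i ∈ T', x i := sum_lt_sum_of_nonempty (card_pos.1 (by omega)) fun i _ => hμ i
  · have hlt := h (c * s) hsμ
    have hyeq : ∑ i, max (c * s - c * y i) 0 = ∑ i ∈ T, (c * s - c * y i) := by
      rw [← sum_subset (subset_univ T)]
      · refine sum_congr rfl fun i hi => max_eq_left ?_
        linarith [mul_le_mul_of_nonneg_left (hs i hi) hc]
      · intro i _ hi
        exact max_eq_right (by linarith [mul_le_mul_of_nonneg_left (hs' i hi) hc])
    have hxle : ∑ i ∈ T', (c * s - x i) ≤ ∑ i, max (c * s - x i) 0 :=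
      (sum_le_sum fun i _ => le_max_left _ _).trans
        (sum_le_sum_of_subset_of_nonneg (subset_univ _) fun i _ _ => le_max_right _ _)
    rw [sum_sub_distrib, sum_const, nsmul_eq_mul] at hxle
    rw [hyeq, sum_sub_distrib, sum_const, nsmul_eq_mul] at hlt
    rw [hcard] at hxle
    linarith

end MinimalSums

lemma IsProbVec.tensor {ι κ : Type*} [Fintype ι] [Fintype κ] {p : ι → ℝ} {r : κ → ℝ}
    (hp : IsProbVec p) (hr : IsProbVec r) : IsProbVec (tensor p r) := by
  refine ⟨fun a => mul_nonneg (hp.1 _) (hr.1 _), ?_⟩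
  simp only [_root_.tensor]
  rw [Fintype.sum_prod_type, ← sum_mul_sum, hp.2, hr.2, one_mul]

lemma sum_posPart_tensor {ι κ : Type*} [Fintype ι] [Fintype κ] (p : ι → ℝ) {r : κ → ℝ}
    (hr : ∀ j, 0 < r j) (c t : ℝ) :
    ∑ a, max (t - c * tensor p r a) 0 = ∑ j, r j * ∑ i, max (t / r j - c * p i) 0 := by
  rw [Fintype.sum_prod_type_right]
  refine sum_congr rfl fun j _ => ?_
  rw [mul_sum]
  refine sum_congr rfl fun i _ => ?_
  rw [mul_max_of_nonneg _ _ (hr j).le, mul_zero, mul_sub, mul_div_cancel₀ _ (hr j).ne']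
  congr 2
  simp only [tensor]
  ring

/-- A decreasing geometric grid with fine enough ratio and enough points, whose top point lies
in `(a, 1)`, meets the window `(a, b]`. -/
lemma exists_geometric_mem {a b α : ℝ} (hα : 0 < α) (hab : a < α * b)
    {N : ℕ} (hN : α ^ N ≤ b) {u : ℝ} (hu : a < u) (hu1 : u < 1) :
    ∃ k ≤ N, a < u * α ^ k ∧ u * α ^ k ≤ b := by
  classical
  have hex : ∃ k, u * α ^ k ≤ b :=
    ⟨N, (mul_le_of_le_one_left (pow_nonneg hα.le N) hu1.le).trans hN⟩
  refine ⟨Nat.find hex, Nat.find_min' hex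
    ((mul_le_of_le_one_left (pow_nonneg hα.le N) hu1.le).trans hN), ?_, Nat.find_spec hex⟩
  rcases hk : Nat.find hex with _ | k
  · simpa using hu
  · have hlt : b < u * α ^ k := not_le.1 (Nat.find_min hex (by omega))
    calc a < α * b := hab
      _ < α * (u * α ^ k) := mul_lt_mul_of_pos_left hlt hα
      _ = u * α ^ (k + 1) := by ring

/-- A catalyst can strictly increase the optimal conversion probability iff
that probability is strictly below `min (p_{d-1}/q_{d-1}) 1`. -/
theorem catalyst_improves_probability_iff
    (d : ℕ) (p q : Fin (d + 1) → ℝ)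
    (hp : IsProbVec p) (hq : IsProbVec q)
    (hpdec : ∀ i j : Fin (d + 1), i ≤ j → p j ≤ p i)
    (hqdec : ∀ i j : Fin (d + 1), i ≤ j → q j ≤ q i)
    (hqpos : ∀ i, 0 < q i) :
    (∃ m : ℕ, 1 ≤ m ∧ ∃ r : Fin m → ℝ, IsProbVec r ∧ (∀ j, 0 < r j) ∧
      Pconv (d + 1) p q < Pconv ((d + 1) * m) (tensor p r) (tensor q r))
    ↔ Pconv (d + 1) p q < min (p (Fin.last d) / q (Fin.last d)) 1 := by
  have hpl : ∀ i, p (Fin.last d) ≤ p i := fun i => hpdec _ _ (Fin.le_last i)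
  have hql : ∀ i, q (Fin.last d) ≤ q i := fun i => hqdec _ _ (Fin.le_last i)
  constructor
  · rintro ⟨m, hm, r, hr, hrpos, hlt⟩
    have : Nonempty (Fin m) := ⟨⟨0, hm⟩⟩
    obtain ⟨j, hj⟩ := Finite.exists_min r
    refine hlt.trans_le ?_
    have h := Pconv_le_min (n := (d + 1) * m) (hp.tensor hr) (hq.tensor hr)
      (by simp) (Fin.last d, j)
      (fun a => mul_le_mul (hpl _) (hj _) (hrpos _).le (hp.1 _))
      (fun a => mul_le_mul (hql _) (hj _) (hrpos _).le (hq.1 _))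
    simpa only [tensor, mul_div_mul_right _ _ (hrpos j).ne'] using h
  · intro hlt
    obtain ⟨hlt1, hlt2⟩ := lt_min_iff.1 hlt
    set c := Pconv (d + 1) p q with hcdef
    set b := p (Fin.last d) with hb
    set a := c * q (Fin.last d) with ha
    have hc : 0 ≤ c := by
      obtain ⟨l, hl, hP⟩ := exists_Pconv_eq (Nat.succ_pos d) p q
      rw [hcdef, hP]
      exact div_nonneg (Cl_nonneg hp (by simpa using hl.le)) (Cl_nonneg hq (by simpa using hl.le))
    have hab : a < b := (lt_div_iff₀ (hqpos _)).1 hlt1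
    have ha0 : 0 ≤ a := mul_nonneg hc (hqpos _).le
    have hb0 : 0 < b := ha0.trans_lt hab
    obtain ⟨α, hα1, hα2⟩ := exists_between ((div_lt_one hb0).2 hab)
    have hα0 : 0 < α := (div_nonneg ha0 hb0.le).trans_lt hα1
    have hαb : a < α * b := (div_lt_iff₀ hb0).1 hα1
    obtain ⟨N, hN⟩ := exists_pow_lt_of_lt_one hb0 hα2
    have hle : ∀ t, ∑ i, max (t - p i) 0 ≤ ∑ i, max (t - c * q i) 0 := by
      refine sum_posPart_le hp hq fun l hl => ?_
      rw [← le_div_iff₀ (Cl_pos hq hqpos hl)]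
      exact Pconv_le p q (by simpa using hl)
    have hlow : ∀ t, a < t → t ≤ b → ∑ i, max (t - p i) 0 < ∑ i, max (t - c * q i) 0 := by
      intro t hat htb
      rw [sum_eq_zero fun i _ => max_eq_right (by linarith [hpl i])]
      exact sum_pos' (fun i _ => le_max_right _ _)
        ⟨Fin.last d, mem_univ _, lt_max_of_lt_left (by linarith)⟩
    have hhigh : ∀ t, 1 ≤ t → ∑ i, max (t - p i) 0 < ∑ i, max (t - c * q i) 0 := by
      intro t ht
      have hp1 : ∀ i, p i ≤ 1 := fun i =>
        hp.2 ▸ single_le_sum (fun j _ => hp.1 j) (mem_univ i)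
      calc ∑ i, max (t - p i) 0 = ∑ i, (t - p i) :=
            sum_congr rfl fun i _ => max_eq_left (by linarith [hp1 i])
        _ < ∑ i, (t - c * q i) := by
            rw [sum_sub_distrib, sum_sub_distrib, ← mul_sum, hp.2, hq.2]
            linarith
        _ ≤ ∑ i, max (t - c * q i) 0 := sum_le_sum fun i _ => le_max_left _ _
    set Z : ℝ := ∑ j : Fin (N + 1), α ^ (j : ℕ) with hZ
    have hZ0 : 0 < Z := sum_pos (fun j _ => pow_pos hα0 _) univ_nonempty
    let r : Fin (N + 1) → ℝ := fun j => α ^ (j : ℕ) / Z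
    have hrpos : ∀ j, 0 < r j := fun j => div_pos (pow_pos hα0 _) hZ0
    have hr : IsProbVec r := ⟨fun j => (hrpos j).le, by
      simp only [r]
      rw [← sum_div, ← hZ, div_self hZ0.ne']⟩
    have hrl : ∀ j, r (Fin.last N) ≤ r j := fun j =>
      div_le_div_of_nonneg_right
        (pow_le_pow_of_le_one hα0.le hα2.le (Fin.le_last j)) hZ0.le
    refine ⟨N + 1, by omega, r, hr, hrpos, ?_⟩
    refine lt_Pconv (μ := a * r (Fin.last N)) (hp.tensor hr) (hq.tensor hr)
      (fun x => mul_pos (hqpos _) (hrpos _)) (by simp) (by positivity) hc ?_ ?_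
    · intro x
      exact (mul_lt_mul_of_pos_right hab (hrpos _)).trans_le
        (mul_le_mul (hpl _) (hrl _) (hrpos _).le (hp.1 _))
    · intro t ht
      have hpt := sum_posPart_tensor p hrpos 1 t
      simp only [one_mul] at hpt
      rw [hpt, sum_posPart_tensor q hrpos c t]
      have hu : a < t / r (Fin.last N) := (lt_div_iff₀ (hrpos _)).2 ht
      have hstrict : ∃ j, ∑ i, max (t / r j - p i) 0 < ∑ i, max (t / r j - c * q i) 0 := by
        rcases le_or_gt 1 (t / r (Fin.last N)) with h1 | h1
        · exact ⟨_, hhigh _ h1⟩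
        · obtain ⟨k, hk, hka, hkb⟩ :=
            exists_geometric_mem hα0 hαb hN.le hu h1
          have hgrid : t / r ⟨N - k, by omega⟩ = t / r (Fin.last N) * α ^ k := by
            have hpow : α ^ N = α ^ (N - k) * α ^ k := by
              rw [← pow_add, Nat.sub_add_cancel hk]
            simp only [r, Fin.val_last, hpow]
            field_simp
          exact ⟨⟨N - k, by omega⟩, hlow _ (hgrid ▸ hka) (hgrid ▸ hkb)⟩
      obtain ⟨j, hj⟩ := hstrict
      exact sum_lt_sum (fun j _ => mul_le_mul_of_nonneg_left (hle _) (hrpos j).le)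
        ⟨j, mem_univ _, mul_lt_mul_of_pos_left hj (hrpos j)⟩
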